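/- arXiv:1908.10496 — 3 statements merged into one kernel-verified Lean document; each statement's English description precedes it below -/
import Mathlib

section
/- For every φ ∈ E of the form φ = eᵢ − eⱼ with i odd and j even, and for every ψ ∈ Φ such that ψ ∉ E, ψ ≠ φ and ψ − φ ∉ Φ, there exists ω ∈ E such that either (ω + ψ ∈ Φ and ω + ψ ≠ φ and (ω + ψ) − φ ∉ Φ) or (ω = −ψ and ψ ≠ −φ). -/
/-- The `i`-th standard basis vector of (an ambient copy of) `ℝ^n`. -/
noncomputable def e (i : ℕ) : ℕ → ℝ := Pi.single i 1

/-- The root system of type `Cₙ`: `{eᵢ - eⱼ, eᵢ + eⱼ, -eᵢ - eⱼ : i ≠ j} ∪ {±2eᵢ}`,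
indices between `1` and `n`. -/
def PhiC (n : ℕ) : Set (ℕ → ℝ) :=
  {v | ∃ i j : ℕ, 1 ≤ i ∧ i ≤ n ∧ 1 ≤ j ∧ j ≤ n ∧ i ≠ j ∧
      (v = e i - e j ∨ v = e i + e j ∨ v = -e i - e j)} ∪
  {v | ∃ i : ℕ, 1 ≤ i ∧ i ≤ n ∧ (v = (2 : ℝ) • e i ∨ v = -((2 : ℝ) • e i))}

/-- The distinguished subset `E ⊆ Φ` of type `Cₙ`:
`{eᵢ - eⱼ : i odd, j even} ∪ {eₘ + eₚ : m ≠ p odd} ∪ {-eₖ - eₗ : k ≠ l even}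
∪ {2eₜ : t odd} ∪ {-2eₛ : s even}`, indices between `1` and `n`. -/
def EC (n : ℕ) : Set (ℕ → ℝ) :=
  {v | ∃ i j : ℕ, 1 ≤ i ∧ i ≤ n ∧ 1 ≤ j ∧ j ≤ n ∧ Odd i ∧ Even j ∧ v = e i - e j} ∪
  {v | ∃ m p : ℕ, 1 ≤ m ∧ m ≤ n ∧ 1 ≤ p ∧ p ≤ n ∧ m ≠ p ∧ Odd m ∧ Odd p ∧
      v = e m + e p} ∪
  {v | ∃ k l : ℕ, 1 ≤ k ∧ k ≤ n ∧ 1 ≤ l ∧ l ≤ n ∧ k ≠ l ∧ Even k ∧ Even l ∧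
      v = -e k - e l} ∪
  {v | ∃ t : ℕ, 1 ≤ t ∧ t ≤ n ∧ Odd t ∧ v = (2 : ℝ) • e t} ∪
  {v | ∃ s : ℕ, 1 ≤ s ∧ s ≤ n ∧ Even s ∧ v = -((2 : ℝ) • e s)}

/-- The signed basis vector: `e k` for odd `k` and `-e k` for even `k`. -/
noncomputable def signedBasis (k : ℕ) : ℕ → ℝ := if Odd k then e k else -e k

lemma signedBasis_of_odd {k : ℕ} (hk : Odd k) : signedBasis k = e k := if_pos hk

lemma signedBasis_of_even {k : ℕ} (hk : Even k) : signedBasis k = -e k :=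
  if_neg (Nat.not_odd_iff_even.2 hk)

lemma signedBasis_apply_self_ne_zero (k : ℕ) : signedBasis k k ≠ 0 := by
  rcases Nat.even_or_odd k with h | h
  · simp [signedBasis_of_even h, e]
  · simp [signedBasis_of_odd h, e]

lemma signedBasis_apply_of_ne {k l : ℕ} (h : l ≠ k) : signedBasis k l = 0 := by
  rcases Nat.even_or_odd k with hk | hk
  · simp [signedBasis_of_even hk, e, h]
  · simp [signedBasis_of_odd hk, e, h]

/-- In the signed basis, `EC n` consists of all sums of two basis vectors. -/
lemma signedBasis_add_mem_EC {n k l : ℕ} (hk : 1 ≤ k) (hkn : k ≤ n) (hl : 1 ≤ l) (hln : l ≤ n) :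
    signedBasis k + signedBasis l ∈ EC n := by
  rcases Nat.even_or_odd k with h | h <;> rcases Nat.even_or_odd l with h' | h'
  · rw [signedBasis_of_even h, signedBasis_of_even h']
    by_cases hkl : k = l
    · subst hkl
      exact Or.inr ⟨k, hk, hkn, h, by rw [two_smul]; abel⟩
    · exact Or.inl (Or.inl (Or.inr ⟨k, l, hk, hkn, hl, hln, hkl, h, h', by abel⟩))
  · rw [signedBasis_of_even h, signedBasis_of_odd h']
    exact Or.inl (Or.inl (Or.inl (Or.inl ⟨l, k, hl, hln, hk, hkn, h', h, by abel⟩)))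
  · rw [signedBasis_of_odd h, signedBasis_of_even h']
    exact Or.inl (Or.inl (Or.inl (Or.inl ⟨k, l, hk, hkn, hl, hln, h, h', by abel⟩)))
  · rw [signedBasis_of_odd h, signedBasis_of_odd h']
    by_cases hkl : k = l
    · subst hkl
      exact Or.inl (Or.inr ⟨k, hk, hkn, h, by rw [two_smul]⟩)
    · exact Or.inl (Or.inl (Or.inl (Or.inr ⟨k, l, hk, hkn, hl, hln, hkl, h, h', rfl⟩)))

lemma signedBasis_add_self_mem_PhiC {n k : ℕ} (hk : 1 ≤ k) (hkn : k ≤ n) :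
    signedBasis k + signedBasis k ∈ PhiC n := by
  refine Or.inr ⟨k, hk, hkn, ?_⟩
  rcases Nat.even_or_odd k with h | h
  · exact Or.inr (by rw [signedBasis_of_even h, two_smul]; abel)
  · exact Or.inl (by rw [signedBasis_of_odd h, two_smul])

lemma signedBasis_sub_mem_PhiC {n k l : ℕ} (hk : 1 ≤ k) (hkn : k ≤ n) (hl : 1 ≤ l) (hln : l ≤ n)
    (hkl : k ≠ l) : signedBasis k - signedBasis l ∈ PhiC n := by
  rcases Nat.even_or_odd k with h | h <;> rcases Nat.even_or_odd l with h' | h'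
  · rw [signedBasis_of_even h, signedBasis_of_even h']
    exact Or.inl ⟨l, k, hl, hln, hk, hkn, hkl.symm, Or.inl (by abel)⟩
  · rw [signedBasis_of_even h, signedBasis_of_odd h']
    exact Or.inl ⟨k, l, hk, hkn, hl, hln, hkl, Or.inr (Or.inr rfl)⟩
  · rw [signedBasis_of_odd h, signedBasis_of_even h']
    exact Or.inl ⟨k, l, hk, hkn, hl, hln, hkl, Or.inr (Or.inl (by abel))⟩
  · rw [signedBasis_of_odd h, signedBasis_of_odd h']
    exact Or.inl ⟨k, l, hk, hkn, hl, hln, hkl, Or.inl rfl⟩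

lemma neg_signedBasis_add_mem_PhiC {n k l : ℕ} (hk : 1 ≤ k) (hkn : k ≤ n) (hl : 1 ≤ l)
    (hln : l ≤ n) : -(signedBasis k + signedBasis l) ∈ PhiC n := by
  by_cases hkl : k = l
  · subst hkl
    refine Or.inr ⟨k, hk, hkn, ?_⟩
    rcases Nat.even_or_odd k with h | h
    · exact Or.inl (by rw [signedBasis_of_even h, two_smul]; abel)
    · exact Or.inr (by rw [signedBasis_of_odd h, two_smul])
  · rcases Nat.even_or_odd k with h | h <;> rcases Nat.even_or_odd l with h' | h'
    · rw [signedBasis_of_even h, signedBasis_of_even h']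
      exact Or.inl ⟨k, l, hk, hkn, hl, hln, hkl, Or.inr (Or.inl (by abel))⟩
    · rw [signedBasis_of_even h, signedBasis_of_odd h']
      exact Or.inl ⟨k, l, hk, hkn, hl, hln, hkl, Or.inl (by abel)⟩
    · rw [signedBasis_of_odd h, signedBasis_of_even h']
      exact Or.inl ⟨l, k, hl, hln, hk, hkn, Ne.symm hkl, Or.inl (by abel)⟩
    · rw [signedBasis_of_odd h, signedBasis_of_odd h']
      exact Or.inl ⟨k, l, hk, hkn, hl, hln, hkl, Or.inr (Or.inr (by abel))⟩

/-- Every root of type `Cₙ` is `±(f k + f l)` or `f k - f l` with `k ≠ l`, where `f` is the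
signed basis. -/
lemma exists_signedBasis_of_mem_PhiC {n : ℕ} {v : ℕ → ℝ} (hv : v ∈ PhiC n) :
    ∃ k l : ℕ, 1 ≤ k ∧ k ≤ n ∧ 1 ≤ l ∧ l ≤ n ∧
      (v = signedBasis k + signedBasis l ∨ v = -(signedBasis k + signedBasis l) ∨
        k ≠ l ∧ v = signedBasis k - signedBasis l) := by
  rcases hv with ⟨k, l, hk, hkn, hl, hln, hkl, hv⟩ | ⟨k, hk, hkn, hv⟩
  · rcases Nat.even_or_odd k with h | h <;> rcases Nat.even_or_odd l with h' | h' <;>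
      rcases hv with rfl | rfl | rfl
    · refine ⟨l, k, hl, hln, hk, hkn, Or.inr (Or.inr ⟨hkl.symm, ?_⟩)⟩
      rw [signedBasis_of_even h, signedBasis_of_even h']; abel
    · refine ⟨k, l, hk, hkn, hl, hln, Or.inr (Or.inl ?_)⟩
      rw [signedBasis_of_even h, signedBasis_of_even h']; abel
    · refine ⟨k, l, hk, hkn, hl, hln, Or.inl ?_⟩
      rw [signedBasis_of_even h, signedBasis_of_even h']; abel
    · refine ⟨k, l, hk, hkn, hl, hln, Or.inr (Or.inl ?_)⟩
      rw [signedBasis_of_even h, signedBasis_of_odd h']; abel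
    · refine ⟨l, k, hl, hln, hk, hkn, Or.inr (Or.inr ⟨hkl.symm, ?_⟩)⟩
      rw [signedBasis_of_even h, signedBasis_of_odd h']; abel
    · refine ⟨k, l, hk, hkn, hl, hln, Or.inr (Or.inr ⟨hkl, ?_⟩)⟩
      rw [signedBasis_of_even h, signedBasis_of_odd h']
    · refine ⟨k, l, hk, hkn, hl, hln, Or.inl ?_⟩
      rw [signedBasis_of_odd h, signedBasis_of_even h']; abel
    · refine ⟨k, l, hk, hkn, hl, hln, Or.inr (Or.inr ⟨hkl, ?_⟩)⟩
      rw [signedBasis_of_odd h, signedBasis_of_even h']; abel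
    · refine ⟨l, k, hl, hln, hk, hkn, Or.inr (Or.inr ⟨hkl.symm, ?_⟩)⟩
      rw [signedBasis_of_odd h, signedBasis_of_even h']; abel
    · refine ⟨k, l, hk, hkn, hl, hln, Or.inr (Or.inr ⟨hkl, ?_⟩)⟩
      rw [signedBasis_of_odd h, signedBasis_of_odd h']
    · refine ⟨k, l, hk, hkn, hl, hln, Or.inl ?_⟩
      rw [signedBasis_of_odd h, signedBasis_of_odd h']
    · refine ⟨k, l, hk, hkn, hl, hln, Or.inr (Or.inl ?_)⟩
      rw [signedBasis_of_odd h, signedBasis_of_odd h']; abel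
  · refine ⟨k, k, hk, hkn, hk, hkn, ?_⟩
    rcases Nat.even_or_odd k with h | h <;> rcases hv with rfl | rfl
    · exact Or.inr (Or.inl (by rw [signedBasis_of_even h, two_smul]; abel))
    · exact Or.inl (by rw [signedBasis_of_even h, two_smul]; abel)
    · exact Or.inl (by rw [signedBasis_of_odd h, two_smul])
    · exact Or.inr (Or.inl (by rw [signedBasis_of_odd h, two_smul]))

/-- A root of type `Cₙ` has at most two nonzero coordinates. -/
lemma notMem_PhiC_of_three_ne_zero {n a b c : ℕ} {v : ℕ → ℝ} (hab : a ≠ b) (hac : a ≠ c)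
    (hbc : b ≠ c) (ha : v a ≠ 0) (hb : v b ≠ 0) (hc : v c ≠ 0) : v ∉ PhiC n := by
  intro hv
  obtain ⟨k, l, -, -, -, -, hv⟩ := exists_signedBasis_of_mem_PhiC hv
  have key : ∀ m, v m ≠ 0 → m = k ∨ m = l := by
    intro m hm
    by_contra! h
    apply hm
    rcases hv with rfl | rfl | ⟨-, rfl⟩ <;>
      simp [signedBasis_apply_of_ne h.1, signedBasis_apply_of_ne h.2]
  have h₁ := key a ha
  have h₂ := key b hb
  have h₃ := key c hc
  omega

/-- Case 1 of the proof of Lemma A.2 of the paper: `φ = eᵢ - eⱼ` with `i` odd, `j` even. -/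
theorem stmt_3 (n : ℕ) (hn : 3 ≤ n) :
    ∀ i j : ℕ, 1 ≤ i → i ≤ n → 1 ≤ j → j ≤ n → Odd i → Even j →
      ∀ ψ ∈ PhiC n, ψ ∉ EC n → ψ ≠ e i - e j → ψ - (e i - e j) ∉ PhiC n →
        ∃ ω ∈ EC n,
          (ω + ψ ∈ PhiC n ∧ ω + ψ ≠ e i - e j ∧ (ω + ψ) - (e i - e j) ∉ PhiC n) ∨
          (ω = -ψ ∧ ψ ≠ -(e i - e j)) := by
  intro i j hi hin hj hjn hio hje ψ hψ hψE _ hψφ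
  have hij : i ≠ j := by
    rintro rfl
    exact Nat.not_odd_iff_even.2 hje hio
  have hφ : e i - e j = signedBasis i + signedBasis j := by
    rw [signedBasis_of_odd hio, signedBasis_of_even hje]; abel
  rw [hφ] at hψφ ⊢
  have hii := signedBasis_apply_self_ne_zero i
  have hjj := signedBasis_apply_self_ne_zero j
  have hfij := signedBasis_apply_of_ne hij
  have hfji := signedBasis_apply_of_ne hij.symm
  obtain ⟨k, l, hk, hkn, hl, hln, rfl | rfl | ⟨hkl, rfl⟩⟩ := exists_signedBasis_of_mem_PhiC hψ
  · exact absurd (signedBasis_add_mem_EC hk hkn hl hln) hψE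
  · by_cases hneg : signedBasis k + signedBasis l = signedBasis i + signedBasis j
    · rw [hneg]
      obtain ⟨m, hm, hmn, hmi, hmj⟩ : ∃ m, 1 ≤ m ∧ m ≤ n ∧ m ≠ i ∧ m ≠ j := by
        by_contra! h
        have h₁ := h 1
        have h₂ := h 2
        have h₃ := h 3
        omega
      have hmm := signedBasis_apply_self_ne_zero m
      have hfmi := signedBasis_apply_of_ne hmi
      have hfmj := signedBasis_apply_of_ne hmj
      have hfim := signedBasis_apply_of_ne hmi.symm
      have hfjm := signedBasis_apply_of_ne hmj.symm
      have hsum : signedBasis i + signedBasis m + -(signedBasis i + signedBasis j) =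
          signedBasis m - signedBasis j := by abel
      refine ⟨signedBasis i + signedBasis m, signedBasis_add_mem_EC hi hin hm hmn, Or.inl ?_⟩
      rw [hsum]
      refine ⟨signedBasis_sub_mem_PhiC hm hmn hj hjn hmj, fun h => hmm ?_,
        notMem_PhiC_of_three_ne_zero hmi hmj hij ?_ ?_ ?_⟩
      · simpa [hfmi, hfmj] using congrFun h m
      · simpa [hfmi, hfmj] using hmm
      · simpa [hfim, hfij] using hii
      · simp only [Pi.sub_apply, Pi.add_apply, hfjm, hfji]
        contrapose! hjj
        linarith
    · exact ⟨signedBasis k + signedBasis l, signedBasis_add_mem_EC hk hkn hl hln,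
        Or.inr ⟨(neg_neg _).symm, fun h => hneg (neg_injective h)⟩⟩
  · have hki : k ≠ i := by
      rintro rfl
      apply hψφ
      convert neg_signedBasis_add_mem_PhiC hl hln hj hjn using 1
      abel
    have hkj : k ≠ j := by
      rintro rfl
      apply hψφ
      convert neg_signedBasis_add_mem_PhiC hl hln hi hin using 1
      abel
    have hkk := signedBasis_apply_self_ne_zero k
    have hfki := signedBasis_apply_of_ne hki
    have hfkj := signedBasis_apply_of_ne hkj
    have hfik := signedBasis_apply_of_ne hki.symm
    have hfjk := signedBasis_apply_of_ne hkj.symm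
    have hsum : signedBasis k + signedBasis l + (signedBasis k - signedBasis l) =
        signedBasis k + signedBasis k := by abel
    refine ⟨signedBasis k + signedBasis l, signedBasis_add_mem_EC hk hkn hl hln, Or.inl ?_⟩
    rw [hsum]
    refine ⟨signedBasis_add_self_mem_PhiC hk hkn, fun h => hkk ?_,
      notMem_PhiC_of_three_ne_zero hki hkj hij ?_ ?_ ?_⟩
    · simpa [hfki, hfkj] using congrFun h k
    · simpa [hfki, hfkj] using hkk
    · simpa [hfik, hfij] using hii
    · simpa [hfjk, hfji] using hjj
end

section
/- For every φ ∈ E of the form φ = eᵢ + eⱼ with i ≠ j, both i and j odd, and for every ψ ∈ Φ such that ψ ∉ E, ψ ≠ φ and ψ − φ ∉ Φ, there exists ω ∈ E such that either (ω + ψ ∈ Φ and ω + ψ ≠ φ and (ω + ψ) − φ ∉ Φ) or (ω = −ψ and ψ ≠ −φ). -/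
/-- The standard basis vector `e i`, negated at even indices. In this basis the set `EC n`
consists of all sums `signedE a + signedE b`. -/
noncomputable def signedE (i : ℕ) : ℕ → ℝ := if Odd i then e i else -e i

theorem signedE_of_odd {i : ℕ} (h : Odd i) : signedE i = e i := if_pos h

theorem signedE_of_even {i : ℕ} (h : Even i) : signedE i = -e i :=
  if_neg (Nat.not_odd_iff_even.2 h)

theorem signedE_self_ne_zero (i : ℕ) : signedE i i ≠ 0 := by
  unfold signedE e
  split_ifs <;> simp

theorem signedE_apply_of_ne {i k : ℕ} (h : k ≠ i) : signedE i k = 0 := by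
  unfold signedE e
  split_ifs <;> simp [h]

theorem signedE_add_mem_EC {n a b : ℕ} (ha : 1 ≤ a) (han : a ≤ n) (hb : 1 ≤ b) (hbn : b ≤ n) :
    signedE a + signedE b ∈ EC n := by
  unfold EC
  rcases Nat.even_or_odd a with pa | pa <;> rcases Nat.even_or_odd b with pb | pb
  · rw [signedE_of_even pa, signedE_of_even pb]
    by_cases hab : a = b
    · subst hab
      exact Or.inr ⟨a, ha, han, pa, by module⟩
    · exact Or.inl (Or.inl (Or.inr ⟨a, b, ha, han, hb, hbn, hab, pa, pb, by module⟩))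
  · rw [signedE_of_even pa, signedE_of_odd pb]
    exact Or.inl (Or.inl (Or.inl (Or.inl ⟨b, a, hb, hbn, ha, han, pb, pa, by module⟩)))
  · rw [signedE_of_odd pa, signedE_of_even pb]
    exact Or.inl (Or.inl (Or.inl (Or.inl ⟨a, b, ha, han, hb, hbn, pa, pb, by module⟩)))
  · rw [signedE_of_odd pa, signedE_of_odd pb]
    by_cases hab : a = b
    · subst hab
      exact Or.inl (Or.inr ⟨a, ha, han, pa, by module⟩)
    · exact Or.inl (Or.inl (Or.inl (Or.inr ⟨a, b, ha, han, hb, hbn, hab, pa, pb, rfl⟩)))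

theorem two_smul_signedE_mem_PhiC {n a : ℕ} (ha : 1 ≤ a) (han : a ≤ n) :
    (2 : ℝ) • signedE a ∈ PhiC n := by
  refine Or.inr ⟨a, ha, han, ?_⟩
  rcases Nat.even_or_odd a with pa | pa
  · rw [signedE_of_even pa]
    exact Or.inr (by module)
  · rw [signedE_of_odd pa]
    exact Or.inl rfl

theorem neg_mem_PhiC {n : ℕ} {v : ℕ → ℝ} (hv : v ∈ PhiC n) : -v ∈ PhiC n := by
  rcases hv with ⟨a, b, ha, han, hb, hbn, hab, rfl | rfl | rfl⟩ | ⟨a, ha, han, rfl | rfl⟩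
  · exact Or.inl ⟨b, a, hb, hbn, ha, han, hab.symm, Or.inl (by module)⟩
  · exact Or.inl ⟨a, b, ha, han, hb, hbn, hab, Or.inr (Or.inr (by module))⟩
  · exact Or.inl ⟨a, b, ha, han, hb, hbn, hab, Or.inr (Or.inl (by module))⟩
  · exact Or.inr ⟨a, ha, han, Or.inr rfl⟩
  · exact Or.inr ⟨a, ha, han, Or.inl (by module)⟩

theorem signedE_add_mem_PhiC {n a b : ℕ} (ha : 1 ≤ a) (han : a ≤ n) (hb : 1 ≤ b)
    (hbn : b ≤ n) : signedE a + signedE b ∈ PhiC n := by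
  by_cases hab : a = b
  · subst hab
    rw [← two_smul ℝ]
    exact two_smul_signedE_mem_PhiC ha han
  · refine Or.inl ?_
    rcases Nat.even_or_odd a with pa | pa <;> rcases Nat.even_or_odd b with pb | pb
    · rw [signedE_of_even pa, signedE_of_even pb]
      exact ⟨a, b, ha, han, hb, hbn, hab, Or.inr (Or.inr (by module))⟩
    · rw [signedE_of_even pa, signedE_of_odd pb]
      exact ⟨b, a, hb, hbn, ha, han, Ne.symm hab, Or.inl (by module)⟩
    · rw [signedE_of_odd pa, signedE_of_even pb]
      exact ⟨a, b, ha, han, hb, hbn, hab, Or.inl (by module)⟩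
    · rw [signedE_of_odd pa, signedE_of_odd pb]
      exact ⟨a, b, ha, han, hb, hbn, hab, Or.inr (Or.inl rfl)⟩

/-- Every root of `PhiC n` outside `EC n` is the negative of an element of `EC n` or a
difference of two distinct signed basis vectors. -/
theorem neg_or_sub_of_mem_PhiC_of_notMem_EC {n : ℕ} {v : ℕ → ℝ} (hv : v ∈ PhiC n)
    (hE : v ∉ EC n) :
    -v ∈ EC n ∨ ∃ a b : ℕ, 1 ≤ a ∧ a ≤ n ∧ 1 ≤ b ∧ b ≤ n ∧ a ≠ b ∧
      v = signedE a - signedE b := by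
  have key : ∀ a b : ℕ, 1 ≤ a → a ≤ n → 1 ≤ b → b ≤ n →
      v = signedE a + signedE b ∨ v = -(signedE a + signedE b) ∨
        (a ≠ b ∧ (v = signedE a - signedE b ∨ v = signedE b - signedE a)) →
      -v ∈ EC n ∨ ∃ a b : ℕ, 1 ≤ a ∧ a ≤ n ∧ 1 ≤ b ∧ b ≤ n ∧ a ≠ b ∧
        v = signedE a - signedE b := by
    rintro a b ha han hb hbn (h | h | ⟨hab, h | h⟩)
    · exact absurd (h ▸ signedE_add_mem_EC ha han hb hbn) hE
    · exact Or.inl (by rw [h, neg_neg]; exact signedE_add_mem_EC ha han hb hbn)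
    · exact Or.inr ⟨a, b, ha, han, hb, hbn, hab, h⟩
    · exact Or.inr ⟨b, a, hb, hbn, ha, han, hab.symm, h⟩
  rcases hv with ⟨a, b, ha, han, hb, hbn, hab, h⟩ | ⟨a, ha, han, h⟩
  · apply key a b ha han hb hbn
    rcases Nat.even_or_odd a with pa | pa <;> rcases Nat.even_or_odd b with pb | pb <;>
      simp only [signedE_of_even, signedE_of_odd, pa, pb] <;>
      rcases h with rfl | rfl | rfl
    · exact Or.inr (Or.inr ⟨hab, Or.inr (by module)⟩)
    · exact Or.inr (Or.inl (by module))
    · exact Or.inl (by module)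
    · exact Or.inr (Or.inl (by module))
    · exact Or.inr (Or.inr ⟨hab, Or.inr (by module)⟩)
    · exact Or.inr (Or.inr ⟨hab, Or.inl (by module)⟩)
    · exact Or.inl (by module)
    · exact Or.inr (Or.inr ⟨hab, Or.inl (by module)⟩)
    · exact Or.inr (Or.inr ⟨hab, Or.inr (by module)⟩)
    · exact Or.inr (Or.inr ⟨hab, Or.inl (by module)⟩)
    · exact Or.inl (by module)
    · exact Or.inr (Or.inl (by module))
  · apply key a a ha han ha han
    rcases Nat.even_or_odd a with pa | pa <;>
      simp only [signedE_of_even, signedE_of_odd, pa] <;>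
      rcases h with rfl | rfl
    · exact Or.inr (Or.inl (by module))
    · exact Or.inl (by module)
    · exact Or.inl (by module)
    · exact Or.inr (Or.inl (by module))

theorem exists_support_of_mem_PhiC {n : ℕ} {v : ℕ → ℝ} (hv : v ∈ PhiC n) :
    ∃ x y : ℕ, ∀ z, z ≠ x → z ≠ y → v z = 0 := by
  rcases hv with ⟨a, b, -, -, -, -, -, rfl | rfl | rfl⟩ | ⟨a, -, -, rfl | rfl⟩
  · exact ⟨a, b, fun z h₁ h₂ => by simp [e, h₁, h₂]⟩
  · exact ⟨a, b, fun z h₁ h₂ => by simp [e, h₁, h₂]⟩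
  · exact ⟨a, b, fun z h₁ h₂ => by simp [e, h₁, h₂]⟩
  · exact ⟨a, a, fun z h₁ _ => by simp [e, h₁]⟩
  · exact ⟨a, a, fun z h₁ _ => by simp [e, h₁]⟩

/-- A combination of three distinct signed basis vectors with nonzero coefficients is not a
root. -/
theorem combination_notMem_PhiC {n a b c : ℕ} (hab : a ≠ b) (hac : a ≠ c) (hbc : b ≠ c)
    {x y z : ℝ} (hx : x ≠ 0) (hy : y ≠ 0) (hz : z ≠ 0) :
    x • signedE a + y • signedE b + z • signedE c ∉ PhiC n := by
  intro h
  obtain ⟨p, q, hpq⟩ := exists_support_of_mem_PhiC h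
  have ha : a = p ∨ a = q := by
    by_contra! H
    have := hpq a H.1 H.2
    simp [signedE_apply_of_ne hab, signedE_apply_of_ne hac, hx, signedE_self_ne_zero] at this
  have hb : b = p ∨ b = q := by
    by_contra! H
    have := hpq b H.1 H.2
    simp [signedE_apply_of_ne hab.symm, signedE_apply_of_ne hbc, hy,
      signedE_self_ne_zero] at this
  have hc : c = p ∨ c = q := by
    by_contra! H
    have := hpq c H.1 H.2
    simp [signedE_apply_of_ne hac.symm, signedE_apply_of_ne hbc.symm, hz,
      signedE_self_ne_zero] at this
  omega

/-- Case 2 of the proof of Lemma A.2 of the paper: `φ = eᵢ + eⱼ` with `i ≠ j` both odd. -/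
theorem stmt_4 (n : ℕ) (hn : 3 ≤ n) :
    ∀ i j : ℕ, 1 ≤ i → i ≤ n → 1 ≤ j → j ≤ n → i ≠ j → Odd i → Odd j →
      ∀ ψ ∈ PhiC n, ψ ∉ EC n → ψ ≠ e i + e j → ψ - (e i + e j) ∉ PhiC n →
        ∃ ω ∈ EC n,
          (ω + ψ ∈ PhiC n ∧ ω + ψ ≠ e i + e j ∧ (ω + ψ) - (e i + e j) ∉ PhiC n) ∨
          (ω = -ψ ∧ ψ ≠ -(e i + e j)) := by
  intro i j hi hin hj hjn hij oi oj ψ hψ hψE _ hsub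
  rw [← signedE_of_odd oi, ← signedE_of_odd oj] at *
  rcases neg_or_sub_of_mem_PhiC_of_notMem_EC hψ hψE with
    hneg | ⟨a, b, ha, han, hb, hbn, hab, rfl⟩
  · by_cases hφ : ψ = -(signedE i + signedE j)
    · subst hφ
      have h2i : 2 ≠ i := by rintro rfl; exact absurd oi (by decide)
      have h2j : 2 ≠ j := by rintro rfl; exact absurd oj (by decide)
      have hsum : signedE i + signedE 2 + -(signedE i + signedE j) = -e 2 - e j := by
        rw [signedE_of_even even_two, signedE_of_odd oj]
        module
      refine ⟨signedE i + signedE 2,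
        signedE_add_mem_EC hi hin one_le_two (by omega), Or.inl ⟨?_, fun h => ?_, ?_⟩⟩
      · rw [hsum]
        exact Or.inl ⟨2, j, one_le_two, by omega, hj, hjn, h2j, Or.inr (Or.inr rfl)⟩
      · have := congrFun h 2
        simp [signedE_apply_of_ne h2i, signedE_apply_of_ne h2j, signedE_self_ne_zero] at this
      · convert combination_notMem_PhiC (n := n) h2i h2j hij (x := 1) (y := -1) (z := -2)
          (by norm_num) (by norm_num) (by norm_num) using 2
        module
    · exact ⟨-ψ, hneg, Or.inr ⟨rfl, hφ⟩⟩
  · have hai : a ≠ i := by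
      rintro rfl
      apply hsub
      convert neg_mem_PhiC (signedE_add_mem_PhiC hb hbn hj hjn) using 1
      module
    have haj : a ≠ j := by
      rintro rfl
      apply hsub
      convert neg_mem_PhiC (signedE_add_mem_PhiC hb hbn hi hin) using 1
      module
    have hsum : signedE a + signedE b + (signedE a - signedE b) = (2 : ℝ) • signedE a := by
      module
    refine ⟨signedE a + signedE b, signedE_add_mem_EC ha han hb hbn, Or.inl ?_⟩
    rw [hsum]
    refine ⟨two_smul_signedE_mem_PhiC ha han, fun h => ?_, ?_⟩
    · have := congrFun h a
      simp [signedE_apply_of_ne hai, signedE_apply_of_ne haj, signedE_self_ne_zero] at this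
    · convert combination_notMem_PhiC (n := n) hai haj hij (x := 2) (y := -1) (z := -1)
        (by norm_num) (by norm_num) (by norm_num) using 2
      module
end

section
/- The set D has cardinality n(n−1)/2, and for all φ, ψ ∈ D one has φ + ψ ∉ Φ and φ + ψ ≠ 0. (Consequently, the corresponding root vectors span an abelian subalgebra of the split Lie algebra of type Dₙ of dimension n(n−1)/2.) -/
/-- The root system of type `Dₙ`: `{eᵢ - eⱼ, eᵢ + eⱼ, -eᵢ - eⱼ : i ≠ j}`,
indices between `1` and `n`. -/
def PhiD (n : ℕ) : Set (ℕ → ℝ) :=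
  {v | ∃ i j : ℕ, 1 ≤ i ∧ i ≤ n ∧ 1 ≤ j ∧ j ≤ n ∧ i ≠ j ∧
      (v = e i - e j ∨ v = e i + e j ∨ v = -e i - e j)}

/-- The distinguished subset `D ⊆ Φ` of type `Dₙ`:
`{eᵢ - eⱼ : i odd, j even} ∪ {eₘ + eₚ : m ≠ p odd} ∪ {-eₖ - eₗ : k ≠ l even}`,
indices between `1` and `n`. -/
def DD (n : ℕ) : Set (ℕ → ℝ) :=
  {v | ∃ i j : ℕ, 1 ≤ i ∧ i ≤ n ∧ 1 ≤ j ∧ j ≤ n ∧ Odd i ∧ Even j ∧ v = e i - e j} ∪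
  {v | ∃ m p : ℕ, 1 ≤ m ∧ m ≤ n ∧ 1 ≤ p ∧ p ≤ n ∧ m ≠ p ∧ Odd m ∧ Odd p ∧
      v = e m + e p} ∪
  {v | ∃ k l : ℕ, 1 ≤ k ∧ k ≤ n ∧ 1 ≤ l ∧ l ≤ n ∧ k ≠ l ∧ Even k ∧ Even l ∧
      v = -e k - e l}

/-- The sign `+1` at odd indices and `-1` at even indices. -/
noncomputable def paritySign (i : ℕ) : ℝ := (-1) ^ (i + 1)

lemma paritySign_odd {i : ℕ} (h : Odd i) : paritySign i = 1 :=
  (h.add_odd odd_one).neg_one_pow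

lemma paritySign_even {i : ℕ} (h : Even i) : paritySign i = -1 :=
  h.add_one.neg_one_pow

lemma paritySign_ne_zero (i : ℕ) : paritySign i ≠ 0 :=
  pow_ne_zero _ (by norm_num)

lemma paritySign_mul_self (i : ℕ) : paritySign i * paritySign i = 1 := by
  rcases Nat.even_or_odd i with h | h
  · simp [paritySign_even h]
  · simp [paritySign_odd h]

/-- The distinguished roots are the sums of two distinct signed basis vectors. -/
lemma mem_DD_iff {n : ℕ} {v : ℕ → ℝ} :
    v ∈ DD n ↔ ∃ i ∈ Finset.Icc 1 n, ∃ j ∈ Finset.Icc 1 n, i ≠ j ∧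
      v = paritySign i • e i + paritySign j • e j := by
  constructor
  · rintro ((⟨i, j, hi, hi', hj, hj', oi, ej, rfl⟩ | ⟨i, j, hi, hi', hj, hj', hij, oi, oj, rfl⟩) |
      ⟨i, j, hi, hi', hj, hj', hij, ei, ej, rfl⟩)
    · refine ⟨i, Finset.mem_Icc.2 ⟨hi, hi'⟩, j, Finset.mem_Icc.2 ⟨hj, hj'⟩, ?_, ?_⟩
      · rintro rfl
        exact Nat.not_even_iff_odd.2 oi ej
      · rw [paritySign_odd oi, paritySign_even ej]
        module
    · refine ⟨i, Finset.mem_Icc.2 ⟨hi, hi'⟩, j, Finset.mem_Icc.2 ⟨hj, hj'⟩, hij, ?_⟩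
      rw [paritySign_odd oi, paritySign_odd oj]
      module
    · refine ⟨i, Finset.mem_Icc.2 ⟨hi, hi'⟩, j, Finset.mem_Icc.2 ⟨hj, hj'⟩, hij, ?_⟩
      rw [paritySign_even ei, paritySign_even ej]
      module
  · rintro ⟨i, hi, j, hj, hij, rfl⟩
    obtain ⟨hi, hi'⟩ := Finset.mem_Icc.1 hi
    obtain ⟨hj, hj'⟩ := Finset.mem_Icc.1 hj
    rcases Nat.even_or_odd i with pi | pi <;> rcases Nat.even_or_odd j with pj | pj
    · refine Or.inr ⟨i, j, hi, hi', hj, hj', hij, pi, pj, ?_⟩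
      rw [paritySign_even pi, paritySign_even pj]
      module
    · refine Or.inl (Or.inl ⟨j, i, hj, hj', hi, hi', pj, pi, ?_⟩)
      rw [paritySign_even pi, paritySign_odd pj]
      module
    · refine Or.inl (Or.inl ⟨i, j, hi, hi', hj, hj', pi, pj, ?_⟩)
      rw [paritySign_odd pi, paritySign_even pj]
      module
    · refine Or.inl (Or.inr ⟨i, j, hi, hi', hj, hj', hij, pi, pj, ?_⟩)
      rw [paritySign_odd pi, paritySign_odd pj]
      module

lemma sum_paritySign_smul_e_apply (s : Finset ℕ) (k : ℕ) :
    (∑ i ∈ s, paritySign i • e i) k = if k ∈ s then paritySign k else 0 := by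
  simp [Finset.sum_apply, e, Pi.single_apply]

lemma sum_paritySign_smul_e_injective :
    Function.Injective fun s : Finset ℕ => ∑ i ∈ s, paritySign i • e i := by
  intro s t h
  ext k
  have hk := congrFun h k
  simp only [sum_paritySign_smul_e_apply] at hk
  by_cases hs : k ∈ s <;> by_cases ht : k ∈ t <;>
    simp_all [paritySign_ne_zero, (paritySign_ne_zero k).symm]

lemma DD_eq_image (n : ℕ) :
    DD n = (fun s : Finset ℕ => ∑ i ∈ s, paritySign i • e i) ''
      ((Finset.Icc 1 n).powersetCard 2 : Finset (Finset ℕ)) := by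
  ext v
  simp only [mem_DD_iff, Set.mem_image, Finset.mem_coe, Finset.mem_powersetCard]
  constructor
  · rintro ⟨i, hi, j, hj, hij, rfl⟩
    exact ⟨{i, j}, ⟨by simp [Finset.insert_subset_iff, Finset.mem_Icc.1 hi, Finset.mem_Icc.1 hj],
      Finset.card_pair hij⟩, Finset.sum_pair hij⟩
  · rintro ⟨s, ⟨hs, hc⟩, rfl⟩
    obtain ⟨i, j, hij, rfl⟩ := Finset.card_eq_two.1 hc
    exact ⟨i, hs (by simp), j, hs (by simp), hij, Finset.sum_pair hij⟩

lemma ncard_DD (n : ℕ) : (DD n).ncard = n * (n - 1) / 2 := by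
  rw [DD_eq_image, Set.ncard_image_of_injective _ sum_paritySign_smul_e_injective,
    Set.ncard_coe_finset, Finset.card_powersetCard, Nat.card_Icc, Nat.add_sub_cancel,
    Nat.choose_two_right]

/-- The linear functional sending `v` to the alternating sum `v₁ - v₂ + v₃ - ⋯ ± vₙ`. -/
noncomputable def alternatingSum (n : ℕ) : (ℕ → ℝ) →ₗ[ℝ] ℝ :=
  ∑ i ∈ Finset.Icc 1 n, paritySign i • LinearMap.proj i

lemma alternatingSum_e {n i : ℕ} (hi : i ∈ Finset.Icc 1 n) :
    alternatingSum n (e i) = paritySign i := by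
  simp only [alternatingSum, LinearMap.sum_apply, LinearMap.smul_apply, LinearMap.proj_apply, e,
    Pi.single_apply, smul_eq_mul, mul_ite, mul_one, mul_zero, Finset.sum_ite_eq', hi, if_true]

lemma alternatingSum_of_mem_DD {n : ℕ} {v : ℕ → ℝ} (hv : v ∈ DD n) :
    alternatingSum n v = 2 := by
  obtain ⟨i, hi, j, hj, -, rfl⟩ := mem_DD_iff.1 hv
  simp only [map_add, map_smul, alternatingSum_e hi, alternatingSum_e hj, smul_eq_mul,
    paritySign_mul_self]
  norm_num

lemma alternatingSum_le_of_mem_PhiD {n : ℕ} {v : ℕ → ℝ} (hv : v ∈ PhiD n) :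
    alternatingSum n v ≤ 2 := by
  obtain ⟨i, j, hi, hi', hj, hj', -, h⟩ := hv
  have ei := alternatingSum_e (Finset.mem_Icc.2 ⟨hi, hi'⟩)
  have ej := alternatingSum_e (Finset.mem_Icc.2 ⟨hj, hj'⟩)
  have si := paritySign_mul_self i
  have sj := paritySign_mul_self j
  rcases h with rfl | rfl | rfl <;> simp only [map_add, map_sub, map_neg, ei, ej] <;>
    nlinarith [sq_nonneg (paritySign i - 1), sq_nonneg (paritySign i + 1),
      sq_nonneg (paritySign j - 1), sq_nonneg (paritySign j + 1)]

/-- Section 3.6, item 4, of the paper: the set `D` of type `Dₙ` has cardinality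
`n(n-1)/2`, and for all `φ, ψ ∈ D` one has `φ + ψ ∉ Φ` and `φ + ψ ≠ 0`. -/
theorem stmt_10 (n : ℕ) (hn : 5 ≤ n) :
    (DD n).ncard = n * (n - 1) / 2 ∧
    ∀ φ ∈ DD n, ∀ ψ ∈ DD n, φ + ψ ∉ PhiD n ∧ φ + ψ ≠ 0 := by
  refine ⟨ncard_DD n, fun φ hφ ψ hψ => ?_⟩
  have hsum : alternatingSum n (φ + ψ) = 4 := by
    rw [map_add, alternatingSum_of_mem_DD hφ, alternatingSum_of_mem_DD hψ]
    norm_num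
  constructor
  · intro h
    linarith [alternatingSum_le_of_mem_PhiD h]
  · intro h
    norm_num [h] at hsum
end
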